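/- arXiv:1910.04820 — 4 statements merged into one kernel-verified Lean document; each statement's English description precedes it below -/
import Mathlib

section
/- Let N ≥ 1 be a natural number and let l, m be real numbers with 0 < l < N, 0 < m < N and l + m − N > 0. Then there exists a constant C > 0 such that for every k ∈ ℤ^N \ {0}, the series ∑_{k₁ ∈ ℤ^N, k₁ ≠ 0, k − k₁ ≠ 0} ‖k₁‖^{−l} ‖k − k₁‖^{−m} converges and is bounded by C · ‖k‖^{−(l+m−N)}. -/
/-- The Euclidean norm of a lattice point `k ∈ ℤ^N`, regarded as a vector in `ℝ^N`. -/
noncomputable def zNorm {N : ℕ} (k : Fin N → ℤ) : ℝ :=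
  Real.sqrt (∑ i, ((k i : ℝ)) ^ 2)

lemma zNorm_eq_norm {N : ℕ} (k : Fin N → ℤ) :
    zNorm k = ‖(WithLp.toLp 2 (fun i => (k i : ℝ)) : EuclideanSpace ℝ (Fin N))‖ := by
  simp [zNorm, EuclideanSpace.norm_eq]

lemma zNorm_nonneg {N : ℕ} (k : Fin N → ℤ) : 0 ≤ zNorm k := Real.sqrt_nonneg _

lemma zNorm_le_add_sub {N : ℕ} (k x : Fin N → ℤ) : zNorm k ≤ zNorm x + zNorm (k - x) := by
  simp only [zNorm_eq_norm]
  refine le_of_eq_of_le (congrArg norm ?_) (norm_add_le _ _)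
  ext i
  simp

lemma abs_apply_le_zNorm {N : ℕ} (k : Fin N → ℤ) (i : Fin N) : |(k i : ℝ)| ≤ zNorm k :=
  Real.abs_le_sqrt <|
    Finset.single_le_sum (f := fun i => (k i : ℝ) ^ 2) (fun _ _ => sq_nonneg _) (Finset.mem_univ i)

lemma one_le_zNorm {N : ℕ} {k : Fin N → ℤ} (hk : k ≠ 0) : 1 ≤ zNorm k := by
  obtain ⟨i, hi⟩ := Function.ne_iff.mp hk
  refine le_trans ?_ (abs_apply_le_zNorm k i)
  exact_mod_cast Int.one_le_abs hi

lemma one_le_zNorm_of_pos {N : ℕ} {k : Fin N → ℤ} (hk : 0 < zNorm k) : 1 ≤ zNorm k := by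
  refine one_le_zNorm ?_
  rintro rfl
  simp [zNorm] at hk

/-- The number of lattice points in a ball of radius `ρ ≥ 1` is at most `(3ρ)^N`. -/
lemma exists_finset_zNorm_le (N : ℕ) {ρ : ℝ} (hρ : 1 ≤ ρ) :
    ∃ T : Finset (Fin N → ℤ), (∀ x, zNorm x ≤ ρ → x ∈ T) ∧ (T.card : ℝ) ≤ (3 * ρ) ^ N := by
  refine ⟨Fintype.piFinset fun _ => Finset.Icc (-⌊ρ⌋) ⌊ρ⌋, fun x hx => ?_, ?_⟩
  · simp only [Fintype.mem_piFinset, Finset.mem_Icc, ← abs_le]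
    intro i
    rw [Int.le_floor, Int.cast_abs]
    exact (abs_apply_le_zNorm x i).trans hx
  · have h0 : (0 : ℤ) ≤ ⌊ρ⌋ := Int.floor_nonneg.mpr (by linarith)
    have hcard : ((Finset.Icc (-⌊ρ⌋) ⌊ρ⌋).card : ℝ) = 2 * ⌊ρ⌋ + 1 := by
      rw [Int.card_Icc, ← Int.cast_natCast, Int.toNat_of_nonneg (by linarith)]
      push_cast
      ring
    rw [Fintype.card_piFinset, Finset.prod_const, Finset.card_univ, Fintype.card_fin,
      Nat.cast_pow, hcard]
    have h0' : (0 : ℝ) ≤ ⌊ρ⌋ := by exact_mod_cast h0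
    gcongr
    linarith [Int.floor_le ρ]

/-- The sum of `‖x‖^{-s}` over a dyadic shell of radius `ρ` is `O(ρ^{N-s})`. -/
lemma tsum_dyadic_shell_le (N : ℕ) {s ρ : ℝ} (hs : 0 < s) (hρ : 0 < ρ) :
    ∑' x : Fin N → ℤ, ENNReal.ofReal
      (if ρ / 2 ≤ zNorm x ∧ zNorm x ≤ ρ then zNorm x ^ (-s) else 0) ≤
      ENNReal.ofReal (3 ^ N * 2 ^ s * ρ ^ (N - s)) := by
  rcases lt_or_ge ρ 1 with h1 | h1
  · refine le_of_eq_of_le (ENNReal.tsum_eq_zero.mpr fun x => ?_) zero_le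
    rw [if_neg, ENNReal.ofReal_zero]
    rintro ⟨h, h'⟩
    linarith [one_le_zNorm_of_pos (k := x) (by linarith)]
  obtain ⟨T, hT, hcard⟩ := exists_finset_zNorm_le N h1
  rw [tsum_eq_sum (s := T) fun x hx => by
    rw [if_neg fun h => hx (hT x h.2), ENNReal.ofReal_zero]]
  have hterm : ∀ x ∈ T, ENNReal.ofReal
      (if ρ / 2 ≤ zNorm x ∧ zNorm x ≤ ρ then zNorm x ^ (-s) else 0) ≤
      ENNReal.ofReal ((ρ / 2) ^ (-s)) := by
    intro x _
    apply ENNReal.ofReal_le_ofReal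
    split_ifs with h
    · exact Real.rpow_le_rpow_of_nonpos (by positivity) h.1 (by linarith)
    · positivity
  refine (Finset.sum_le_card_nsmul T _ _ hterm).trans ?_
  rw [nsmul_eq_mul, ← ENNReal.ofReal_natCast, ← ENNReal.ofReal_mul (by positivity)]
  apply ENNReal.ofReal_le_ofReal
  calc (T.card : ℝ) * (ρ / 2) ^ (-s) ≤ (3 * ρ) ^ N * (ρ / 2) ^ (-s) := by gcongr
    _ = 3 ^ N * 2 ^ s * ρ ^ (N - s) := by
      rw [Real.div_rpow hρ.le (by norm_num), Real.rpow_neg (by norm_num : (0 : ℝ) ≤ 2),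
        mul_pow, sub_eq_add_neg, Real.rpow_add hρ, Real.rpow_natCast, div_inv_eq_mul]
      ring

/-- A function dominated by `‖x‖^{-s}` and supported on dyadic shells whose radii form a geometric
progression with `q^{N-s} < 1` has sum of the order of the first shell. -/
lemma tsum_geometric_shells_le (N : ℕ) {s q r : ℝ} (hs : 0 < s) (hq : 0 < q) (hr : 0 < r)
    (hq1 : q ^ (N - s) < 1) {g : (Fin N → ℤ) → ℝ}
    (hg : ∀ x, g x ≤ 0 ∨
      ∃ j : ℕ, (r * q ^ j / 2 ≤ zNorm x ∧ zNorm x ≤ r * q ^ j) ∧ g x ≤ zNorm x ^ (-s)) :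
    ∑' x, ENNReal.ofReal (g x) ≤
      ENNReal.ofReal (3 ^ N * 2 ^ s * (1 - q ^ (N - s))⁻¹ * r ^ (N - s)) := by
  have hq0 : 0 ≤ q ^ (N - s) := by positivity
  calc ∑' x, ENNReal.ofReal (g x)
      ≤ ∑' x : Fin N → ℤ, ∑' j : ℕ, ENNReal.ofReal
        (if r * q ^ j / 2 ≤ zNorm x ∧ zNorm x ≤ r * q ^ j then zNorm x ^ (-s) else 0) := by
        refine ENNReal.tsum_le_tsum fun x => ?_
        rcases hg x with h | ⟨j, hj, h⟩
        · simp [ENNReal.ofReal_of_nonpos h]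
        · refine le_trans ?_ (ENNReal.le_tsum j)
          rw [if_pos hj]
          exact ENNReal.ofReal_le_ofReal h
    _ = ∑' j : ℕ, ∑' x : Fin N → ℤ, ENNReal.ofReal
        (if r * q ^ j / 2 ≤ zNorm x ∧ zNorm x ≤ r * q ^ j then zNorm x ^ (-s) else 0) :=
        ENNReal.tsum_comm
    _ ≤ ∑' j : ℕ, ENNReal.ofReal (3 ^ N * 2 ^ s * r ^ (N - s) * (q ^ (N - s)) ^ j) := by
        refine ENNReal.tsum_le_tsum fun j => ?_
        refine (tsum_dyadic_shell_le N hs (by positivity)).trans_eq ?_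
        rw [Real.mul_rpow hr.le (by positivity), Real.rpow_pow_comm hq.le, mul_assoc, mul_assoc,
          mul_assoc]
    _ = ENNReal.ofReal (3 ^ N * 2 ^ s * (1 - q ^ (N - s))⁻¹ * r ^ (N - s)) := by
        rw [← ENNReal.ofReal_tsum_of_nonneg (fun j => by positivity)
          ((summable_geometric_of_lt_one hq0 hq1).mul_left _), tsum_mul_left,
          tsum_geometric_of_lt_one hq0 hq1]
        congr 1
        ring

lemma tsum_zNorm_rpow_ball_le (N : ℕ) {s : ℝ} (hs : 0 < s) (hsN : s < N) :
    ∃ C : ℝ, 0 < C ∧ ∀ r : ℝ, 0 < r →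
      ∑' x : Fin N → ℤ, ENNReal.ofReal (if zNorm x ≤ r then zNorm x ^ (-s) else 0) ≤
        ENNReal.ofReal (C * r ^ (N - s)) := by
  have hq : (1 / 2 : ℝ) ^ (N - s) < 1 :=
    Real.rpow_lt_one (by norm_num) (by norm_num) (by linarith)
  have := sub_pos.mpr hq
  refine ⟨3 ^ N * 2 ^ s * (1 - (1 / 2 : ℝ) ^ (N - s))⁻¹, by positivity, fun r hr => ?_⟩
  refine tsum_geometric_shells_le N hs (by norm_num) hr hq fun x => ?_
  split_ifs with h
  · rcases (zNorm_nonneg x).eq_or_lt' with h0 | h0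
    · left
      rw [h0, Real.zero_rpow (by linarith)]
    · right
      obtain ⟨j, hj, hj'⟩ := exists_nat_pow_near_of_lt_one (div_pos h0 hr)
        ((div_le_one hr).mpr h) (by norm_num : (0 : ℝ) < 1 / 2) (by norm_num)
      rw [lt_div_iff₀ hr, pow_succ] at hj
      rw [div_le_iff₀ hr] at hj'
      exact ⟨j, ⟨by linarith, by linarith⟩, le_rfl⟩
  · exact Or.inl le_rfl

lemma tsum_zNorm_rpow_compl_ball_le (N : ℕ) {s : ℝ} (hsN : N < s) :
    ∃ C : ℝ, 0 < C ∧ ∀ r : ℝ, 0 < r →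
      ∑' x : Fin N → ℤ, ENNReal.ofReal (if r < zNorm x then zNorm x ^ (-s) else 0) ≤
        ENNReal.ofReal (C * r ^ (N - s)) := by
  have hs : 0 < s := (Nat.cast_nonneg N).trans_lt hsN
  have hq : (2 : ℝ) ^ (N - s) < 1 :=
    Real.rpow_lt_one_of_one_lt_of_neg (by norm_num) (by linarith)
  have := sub_pos.mpr hq
  refine ⟨3 ^ N * 2 ^ s * (1 - (2 : ℝ) ^ (N - s))⁻¹ * 2 ^ (N - s), by positivity,
    fun r hr => ?_⟩
  rw [mul_assoc, ← Real.mul_rpow (by norm_num) hr.le]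
  refine tsum_geometric_shells_le N hs (by norm_num) (by positivity) hq fun x => ?_
  split_ifs with h
  · right
    obtain ⟨j, hj, hj'⟩ := exists_nat_pow_near ((one_le_div hr).mpr h.le) (one_lt_two (α := ℝ))
    rw [le_div_iff₀ hr] at hj
    rw [div_lt_iff₀ hr, pow_succ] at hj'
    exact ⟨j, ⟨by linarith, by linarith⟩, le_rfl⟩
  · exact Or.inl le_rfl

/-- Splitting of `a^{-l} b^{-m}` according to which of `a`, `b` are at most `r`. -/
lemma rpow_neg_mul_rpow_neg_le {l m r a b : ℝ} (hl : 0 < l) (hm : 0 < m) (hr : 0 < r)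
    (ha : 0 ≤ a) (hb : 0 ≤ b) (hab : 2 * r ≤ a + b) :
    a ^ (-l) * b ^ (-m) ≤
      r ^ (-m) * (if a ≤ r then a ^ (-l) else 0) + r ^ (-l) * (if b ≤ r then b ^ (-m) else 0) +
      ((if r < a then a ^ (-(l + m)) else 0) + (if r < b then b ^ (-(l + m)) else 0)) := by
  have h1 : 0 ≤ r ^ (-m) * (if a ≤ r then a ^ (-l) else 0) := by split_ifs <;> positivity
  have h2 : 0 ≤ r ^ (-l) * (if b ≤ r then b ^ (-m) else 0) := by split_ifs <;> positivity
  have h3 : 0 ≤ if r < a then a ^ (-(l + m)) else 0 := by split_ifs <;> positivity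
  have h4 : 0 ≤ if r < b then b ^ (-(l + m)) else 0 := by split_ifs <;> positivity
  rcases le_or_gt a r with h | h
  · have : a ^ (-l) * b ^ (-m) ≤ r ^ (-m) * (if a ≤ r then a ^ (-l) else 0) := by
      rw [if_pos h, mul_comm]
      gcongr ?_ * _
      exact Real.rpow_le_rpow_of_nonpos hr (by linarith) (by linarith)
    linarith
  rcases le_or_gt b r with h' | h'
  · have : a ^ (-l) * b ^ (-m) ≤ r ^ (-l) * (if b ≤ r then b ^ (-m) else 0) := by
      rw [if_pos h']
      gcongr ?_ * _
      exact Real.rpow_le_rpow_of_nonpos hr (by linarith) (by linarith)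
    linarith
  have ha' := hr.trans h
  have hb' := hr.trans h'
  rcases le_total a b with hle | hle
  · have : a ^ (-l) * b ^ (-m) ≤ if r < a then a ^ (-(l + m)) else 0 := by
      rw [if_pos h, neg_add, Real.rpow_add ha']
      gcongr _ * ?_
      exact Real.rpow_le_rpow_of_nonpos ha' hle (by linarith)
    linarith
  · have : a ^ (-l) * b ^ (-m) ≤ if r < b then b ^ (-(l + m)) else 0 := by
      rw [if_pos h', neg_add, Real.rpow_add hb']
      gcongr ?_ * _
      exact Real.rpow_le_rpow_of_nonpos hb' hle (by linarith)
    linarith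

lemma summable_and_tsum_le_of_tsum_ofReal_le {α : Type*} {f : α → ℝ} {B : ℝ}
    (hf : ∀ x, 0 ≤ f x) (hB : 0 ≤ B) (h : ∑' x, ENNReal.ofReal (f x) ≤ ENNReal.ofReal B) :
    Summable f ∧ ∑' x, f x ≤ B := by
  have hsum : ∀ t : Finset α, ∑ x ∈ t, f x ≤ B := fun t => by
    rw [← ENNReal.ofReal_le_ofReal_iff hB, ENNReal.ofReal_sum_of_nonneg fun x _ => hf x]
    exact (ENNReal.sum_le_tsum t).trans h
  exact ⟨summable_of_sum_le hf hsum, Real.tsum_le_of_sum_le hf hsum⟩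

/-- Lemma 2.9: for `0 < l < N`, `0 < m < N` with `l + m - N > 0`, there is a constant `C > 0`
such that for every `k ∈ ℤ^N \ {0}`, the series
`∑_{k₁ ≠ 0, k - k₁ ≠ 0} ‖k₁‖^{-l} ‖k - k₁‖^{-m}` converges and is bounded by
`C ‖k‖^{-(l+m-N)}`. -/
theorem lattice_convolution_sum_bound
    (N : ℕ) (hN : 1 ≤ N) (l m : ℝ)
    (hl0 : 0 < l) (hlN : l < N) (hm0 : 0 < m) (hmN : m < N)
    (hlm : 0 < l + m - N) :
    ∃ C : ℝ, 0 < C ∧ ∀ k : Fin N → ℤ, k ≠ 0 →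
      Summable (fun k₁ : Fin N → ℤ =>
        if k₁ ≠ 0 ∧ k - k₁ ≠ 0 then zNorm k₁ ^ (-l) * zNorm (k - k₁) ^ (-m) else 0) ∧
      (∑' k₁ : Fin N → ℤ,
          if k₁ ≠ 0 ∧ k - k₁ ≠ 0 then zNorm k₁ ^ (-l) * zNorm (k - k₁) ^ (-m) else 0)
        ≤ C * zNorm k ^ (-(l + m - N)) := by
  obtain ⟨A, hA, hballl⟩ := tsum_zNorm_rpow_ball_le N hl0 hlN
  obtain ⟨B, hB, hballm⟩ := tsum_zNorm_rpow_ball_le N hm0 hmN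
  obtain ⟨D, hD, htail⟩ := tsum_zNorm_rpow_compl_ball_le N (s := l + m) (by linarith)
  refine ⟨(A + B + (D + D)) * (1 / 2) ^ (-(l + m - N)), by positivity, fun k hk => ?_⟩
  have hk1 := one_le_zNorm hk
  obtain ⟨r, hr⟩ : ∃ r, r = 1 / 2 * zNorm k := ⟨_, rfl⟩
  have hr0 : 0 < r := by linarith
  rw [mul_assoc, ← Real.mul_rpow (by norm_num) (by linarith), ← hr]
  have hterm : ∀ x : Fin N → ℤ, 0 ≤ zNorm x ^ (-l) * zNorm (k - x) ^ (-m) := fun x =>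
    mul_nonneg (Real.rpow_nonneg (zNorm_nonneg _) _) (Real.rpow_nonneg (zNorm_nonneg _) _)
  refine summable_and_tsum_le_of_tsum_ofReal_le
    (fun x => by split_ifs <;> first | exact hterm x | exact le_rfl) (by positivity) ?_
  have hreflect : ∀ f : (Fin N → ℤ) → ENNReal, ∑' x, f (k - x) = ∑' x, f x := fun f =>
    (Equiv.subLeft k).tsum_eq f
  have hscale : ∀ {u v E : ℝ} {S : ENNReal}, u + v = -(l + m - N) →
      S ≤ ENNReal.ofReal (E * r ^ v) →
      ENNReal.ofReal (r ^ u) * S ≤ ENNReal.ofReal (E * r ^ (-(l + m - N))) := by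
    intro u v E S huv h
    refine (mul_le_mul_right h _).trans_eq ?_
    rw [← ENNReal.ofReal_mul (by positivity), ← huv, Real.rpow_add hr0]
    congr 1
    ring
  have htail' := htail r hr0
  rw [show (N : ℝ) - (l + m) = -(l + m - N) by ring] at htail'
  let P (s : ℝ) (x : Fin N → ℤ) : ENNReal :=
    ENNReal.ofReal (if zNorm x ≤ r then zNorm x ^ (-s) else 0)
  let Q (x : Fin N → ℤ) : ENNReal :=
    ENNReal.ofReal (if r < zNorm x then zNorm x ^ (-(l + m)) else 0)
  calc _ ≤ ∑' x, (ENNReal.ofReal (r ^ (-m)) * P l x + ENNReal.ofReal (r ^ (-l)) * P m (k - x) +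
        (Q x + Q (k - x))) := by
        refine ENNReal.tsum_le_tsum fun x => ?_
        simp only [P, Q]
        rw [← ENNReal.ofReal_mul (by positivity), ← ENNReal.ofReal_mul (by positivity)]
        refine le_trans ?_ ((ENNReal.ofReal_le_ofReal (rpow_neg_mul_rpow_neg_le hl0 hm0 hr0
          (zNorm_nonneg x) (zNorm_nonneg (k - x)) ?_)).trans ?_)
        · apply ENNReal.ofReal_le_ofReal
          split_ifs
          exacts [le_rfl, hterm x]
        · linarith [zNorm_le_add_sub k x]
        · exact ENNReal.ofReal_add_le.trans (add_le_add ENNReal.ofReal_add_le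
            ENNReal.ofReal_add_le)
    _ = ENNReal.ofReal (r ^ (-m)) * ∑' x, P l x + ENNReal.ofReal (r ^ (-l)) * ∑' x, P m x +
        (∑' x, Q x + ∑' x, Q x) := by
        rw [ENNReal.tsum_add, ENNReal.tsum_add, ENNReal.tsum_add, ENNReal.tsum_mul_left,
          ENNReal.tsum_mul_left, hreflect (P m), hreflect Q]
    _ ≤ ENNReal.ofReal (A * r ^ (-(l + m - N))) + ENNReal.ofReal (B * r ^ (-(l + m - N))) +
        (ENNReal.ofReal (D * r ^ (-(l + m - N))) + ENNReal.ofReal (D * r ^ (-(l + m - N)))) :=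
        add_le_add (add_le_add (hscale (by ring) (hballl r hr0)) (hscale (by ring) (hballm r hr0)))
          (add_le_add htail' htail')
    _ = ENNReal.ofReal ((A + B + (D + D)) * r ^ (-(l + m - N))) := by
        rw [← ENNReal.ofReal_add (by positivity) (by positivity),
          ← ENNReal.ofReal_add (by positivity) (by positivity),
          ← ENNReal.ofReal_add (by positivity) (by positivity), add_mul, add_mul, add_mul]
end

section
/- Let ξ₁₁, ξ₁₂, ξ₁₃, ξ₁₄, ξ₂₁, ξ₂₂, ξ₂₃, ξ₂₄ be real random variables on a probability space that are jointly Gaussian and centered. Then E[:ξ₁₁ξ₁₂ξ₁₃ξ₁₄: · :ξ₂₁ξ₂₂ξ₂₃ξ₂₄:] = ∑_σ ∏_{i=1}^{4} E[ξ₁ᵢ ξ₂σ(i)], where the sum runs over all 24 permutations σ of {1,2,3,4}. -/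
open MeasureTheory ProbabilityTheory

/-- Real random variables `ξ 0, …, ξ (n-1)` on a probability space are jointly Gaussian and
centered: they are measurable, the pushforward of `P` under `ω ↦ (ξ 0 ω, …, ξ (n-1) ω)` maps
to a one-dimensional Gaussian distribution under every continuous linear functional
`ℝⁿ → ℝ`, and each `ξ i` has mean zero. -/
def IsJointlyGaussianCentered {Ω : Type*} [MeasurableSpace Ω] (P : Measure Ω)
    {n : ℕ} (ξ : Fin n → Ω → ℝ) : Prop :=
  Measurable (fun ω i => ξ i ω) ∧
  (∀ L : (Fin n → ℝ) →L[ℝ] ℝ, ∃ μ : ℝ, ∃ v : NNReal,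
      Measure.map (fun x => L x) (Measure.map (fun ω i => ξ i ω) P) = gaussianReal μ v) ∧
  ∀ i : Fin n, ∫ ω, ξ i ω ∂P = 0

/-- The fourth-order Wick product
`:ξ₁ξ₂ξ₃ξ₄: = ξ₁ξ₂ξ₃ξ₄ - E[ξ₁ξ₂]ξ₃ξ₄ - E[ξ₁ξ₃]ξ₂ξ₄ - E[ξ₁ξ₄]ξ₂ξ₃ - E[ξ₂ξ₃]ξ₁ξ₄
  - E[ξ₂ξ₄]ξ₁ξ₃ - E[ξ₃ξ₄]ξ₁ξ₂ + E[ξ₁ξ₂]E[ξ₃ξ₄] + E[ξ₁ξ₃]E[ξ₂ξ₄] + E[ξ₁ξ₄]E[ξ₂ξ₃]`. -/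
noncomputable def wick4 {Ω : Type*} [MeasurableSpace Ω] (P : Measure Ω)
    (f₁ f₂ f₃ f₄ : Ω → ℝ) : Ω → ℝ :=
  fun ω => f₁ ω * f₂ ω * f₃ ω * f₄ ω
    - (∫ ω', f₁ ω' * f₂ ω' ∂P) * (f₃ ω * f₄ ω)
    - (∫ ω', f₁ ω' * f₃ ω' ∂P) * (f₂ ω * f₄ ω)
    - (∫ ω', f₁ ω' * f₄ ω' ∂P) * (f₂ ω * f₃ ω)
    - (∫ ω', f₂ ω' * f₃ ω' ∂P) * (f₁ ω * f₄ ω)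
    - (∫ ω', f₂ ω' * f₄ ω' ∂P) * (f₁ ω * f₃ ω)
    - (∫ ω', f₃ ω' * f₄ ω' ∂P) * (f₁ ω * f₂ ω)
    + (∫ ω', f₁ ω' * f₂ ω' ∂P) * (∫ ω', f₃ ω' * f₄ ω' ∂P)
    + (∫ ω', f₁ ω' * f₃ ω' ∂P) * (∫ ω', f₂ ω' * f₄ ω' ∂P)
    + (∫ ω', f₁ ω' * f₄ ω' ∂P) * (∫ ω', f₂ ω' * f₃ ω' ∂P)

/-- The fourth Hermite polynomial with variance parameter `c`. -/
def hermiteFour (x c : ℝ) : ℝ := x ^ 4 - 6 * c * x ^ 2 + 3 * c ^ 2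

/-- The eight sign vectors of length four with first entry `1`. -/
def signVec (b : Bool × Bool × Bool) : Fin 4 → ℝ :=
  ![1, if b.1 then 1 else -1, if b.2.1 then 1 else -1, if b.2.2 then 1 else -1]

lemma sum_signVec_mul_hermiteFour (x : Fin 4 → ℝ) (c : Fin 4 → Fin 4 → ℝ)
    (hc : ∀ i j, c i j = c j i) :
    ∑ b, (∏ i, signVec b i) * hermiteFour (∑ i, signVec b i * x i)
        (∑ i, ∑ j, signVec b i * signVec b j * c i j) =
      192 * (x 0 * x 1 * x 2 * x 3 - c 0 1 * (x 2 * x 3) - c 0 2 * (x 1 * x 3)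
        - c 0 3 * (x 1 * x 2) - c 1 2 * (x 0 * x 3) - c 1 3 * (x 0 * x 2) - c 2 3 * (x 0 * x 1)
        + c 0 1 * c 2 3 + c 0 2 * c 1 3 + c 0 3 * c 1 2) := by
  simp [Fintype.sum_prod_type, signVec, Fin.sum_univ_four, Fin.prod_univ_four, hermiteFour,
    hc 1 0, hc 2 0, hc 3 0, hc 2 1, hc 3 1, hc 3 2]
  ring

lemma sum_signVec_mul_pow_four (x : Fin 4 → ℝ) :
    ∑ b, (∏ i, signVec b i) * (∑ i, signVec b i * x i) ^ 4 = 192 * ∏ i, x i := by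
  simp [Fintype.sum_prod_type, signVec, Fin.sum_univ_four, Fin.prod_univ_four]
  ring

lemma sum_signVec_mul_prod (c : Fin 4 → Fin 4 → ℝ) :
    ∑ b, (∏ i, signVec b i) * ∏ i, ∑ j, signVec b j * c i j =
      8 * ∑ σ : Equiv.Perm (Fin 4), ∏ i, c i (σ i) := by
  have h42 (p : Fin 4) (e : Equiv.Perm (Fin 3)) :
      Equiv.Perm.decomposeFin.symm (p, e) 2 = Equiv.swap 0 p (e 1).succ :=
    Equiv.Perm.decomposeFin_symm_apply_succ e p 1
  have h43 (p : Fin 4) (e : Equiv.Perm (Fin 3)) :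
      Equiv.Perm.decomposeFin.symm (p, e) 3 = Equiv.swap 0 p (e 2).succ :=
    Equiv.Perm.decomposeFin_symm_apply_succ e p 2
  have h32 (p : Fin 3) (e : Equiv.Perm (Fin 2)) :
      Equiv.Perm.decomposeFin.symm (p, e) 2 = Equiv.swap 0 p (e 1).succ :=
    Equiv.Perm.decomposeFin_symm_apply_succ e p 1
  simp [signVec, Fin.sum_univ_succ, Fin.prod_univ_succ,
    Finset.univ_perm_fin_succ, ← Finset.univ_product_univ, Finset.sum_product, h42, h43, h32,
    Equiv.swap_apply_def]
  ring

section Gauss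
open scoped NNReal ENNReal

lemma iteratedDeriv_exp_mul_sq_add_two (v : ℝ) (n : ℕ) (t : ℝ) :
    iteratedDeriv (n + 2) (fun s : ℝ => Real.exp (v * s ^ 2 / 2)) t =
      v * t * iteratedDeriv (n + 1) (fun s : ℝ => Real.exp (v * s ^ 2 / 2)) t
        + (n + 1) * v * iteratedDeriv n (fun s : ℝ => Real.exp (v * s ^ 2 / 2)) t := by
  set M := fun s : ℝ => Real.exp (v * s ^ 2 / 2) with hM
  have hd (k : ℕ) (s : ℝ) : HasDerivAt (iteratedDeriv k M) (iteratedDeriv (k + 1) M s) s := by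
    have hsm : ContDiff ℝ (k + 1 : ℕ) M := by fun_prop
    rw [iteratedDeriv_succ]
    exact ((hsm.differentiable_iteratedDeriv k (by exact_mod_cast Nat.lt_succ_self k)) s).hasDerivAt
  have h1 (s : ℝ) : iteratedDeriv 1 M s = v * s * M s := by
    rw [iteratedDeriv_one]
    have : HasDerivAt M (Real.exp (v * s ^ 2 / 2) * (v * (2 * s ^ (2 - 1) * 1) / 2)) s :=
      ((((hasDerivAt_id s).pow 2).const_mul v).div_const 2).exp
    rw [this.deriv]
    simp only [hM]
    ring
  induction n generalizing t with
  | zero =>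
    have h : HasDerivAt (fun s => v * s * M s)
        (v * 1 * M t + v * t * iteratedDeriv 1 M t) t :=
      ((hasDerivAt_id t).const_mul v).mul (by simpa using hd 0 t)
    rw [zero_add, iteratedDeriv_succ, funext h1, h.deriv, h1]
    simp
    ring
  | succ n ih =>
    have h : HasDerivAt (fun s => v * s * iteratedDeriv (n + 1) M s
        + (n + 1) * v * iteratedDeriv n M s)
        ((v * 1 * iteratedDeriv (n + 1) M t + v * t * iteratedDeriv (n + 2) M t)
          + (n + 1) * v * iteratedDeriv (n + 1) M t) t :=
      (((hasDerivAt_id t).const_mul v).mul (hd (n + 1) t)).add ((hd n t).const_mul _)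
    rw [iteratedDeriv_succ, funext ih, h.deriv]
    push_cast
    linear_combination v * t * ih t

lemma integral_pow_add_two_gaussianReal (v : ℝ≥0) (n : ℕ) :
    ∫ x, x ^ (n + 2) ∂gaussianReal 0 v = (n + 1) * v * ∫ x, x ^ n ∂gaussianReal 0 v := by
  have h (k : ℕ) : iteratedDeriv k (fun s : ℝ => Real.exp (v * s ^ 2 / 2)) 0 =
      ∫ x, x ^ k ∂gaussianReal 0 v := by
    have := iteratedDeriv_mgf_zero (X := id) (μ := gaussianReal 0 v) (by simp) k
    rw [mgf_id_gaussianReal] at this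
    simpa using this
  rw [← h, ← h, iteratedDeriv_exp_mul_sq_add_two]
  simp

variable {Ω : Type*} [MeasurableSpace Ω] {P : Measure Ω}

lemma ProbabilityTheory.HasGaussianLaw.integral_pow_add_two {X : Ω → ℝ}
    (hX : HasGaussianLaw X P) (h0 : ∫ ω, X ω ∂P = 0) (n : ℕ) :
    ∫ ω, X ω ^ (n + 2) ∂P = (n + 1) * (∫ ω, X ω ^ 2 ∂P) * ∫ ω, X ω ^ n ∂P := by
  have hl : HasLaw X (gaussianReal 0 (Var[X; P]).toNNReal) P := by
    refine ⟨hX.aemeasurable, ?_⟩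
    rw [hX.map_eq_gaussianReal, h0]
  have hk (k : ℕ) :
      ∫ ω, X ω ^ k ∂P = ∫ x, x ^ k ∂gaussianReal 0 (Var[X; P]).toNNReal :=
    hl.integral_comp (f := fun x => x ^ k) (by fun_prop)
  have h2 := integral_pow_add_two_gaussianReal (Var[X; P]).toNNReal 0
  rw [hk, hk, hk, integral_pow_add_two_gaussianReal, h2]
  simp

/-- All absolute moments of `X` are finite. -/
def HasAllMoments (X : Ω → ℝ) (P : Measure Ω) : Prop :=
  ∀ p : ℝ≥0∞, p ≠ ∞ → MemLp X p P

namespace HasAllMoments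

variable {X Y : Ω → ℝ}

lemma integrable (hX : HasAllMoments X P) : Integrable X P :=
  memLp_one_iff_integrable.1 (hX 1 (by simp))

lemma const [IsFiniteMeasure P] (c : ℝ) : HasAllMoments (fun _ => c) P :=
  fun _ _ => memLp_const c

lemma mul (hX : HasAllMoments X P) (hY : HasAllMoments Y P) :
    HasAllMoments (fun ω => X ω * Y ω) P := by
  intro p hp
  have h2 : 2 * p ≠ ∞ := ENNReal.mul_ne_top (by simp) hp
  have : ENNReal.HolderTriple (2 * p) (2 * p) p := ⟨by
    rw [ENNReal.mul_inv (by simp) (by simp), ← add_mul, ENNReal.inv_two_add_inv_two, one_mul]⟩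
  exact (hY _ h2).mul' (hX _ h2)

lemma pow [IsFiniteMeasure P] (hX : HasAllMoments X P) (n : ℕ) :
    HasAllMoments (fun ω => X ω ^ n) P := by
  induction n with
  | zero => simpa using const 1
  | succ n ih => simpa only [pow_succ] using ih.mul hX

lemma add (hX : HasAllMoments X P) (hY : HasAllMoments Y P) :
    HasAllMoments (fun ω => X ω + Y ω) P :=
  fun p hp => (hX p hp).add (hY p hp)

lemma sub (hX : HasAllMoments X P) (hY : HasAllMoments Y P) :
    HasAllMoments (fun ω => X ω - Y ω) P :=
  fun p hp => (hX p hp).sub (hY p hp)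

lemma hermiteFour [IsFiniteMeasure P] (hX : HasAllMoments X P) (c : ℝ) :
    HasAllMoments (fun ω => hermiteFour (X ω) c) P :=
  ((hX.pow 4).sub ((const (6 * c)).mul (hX.pow 2))).add (const _)

end HasAllMoments

lemma integral_add_mul_pow [IsFiniteMeasure P] {X Y : Ω → ℝ} (hX : HasAllMoments X P)
    (hY : HasAllMoments Y P) (k : ℝ) (n : ℕ) :
    ∫ ω, (X ω + k * Y ω) ^ n ∂P =
      ∑ m ∈ Finset.range (n + 1), k ^ (n - m) * n.choose m * ∫ ω, X ω ^ m * Y ω ^ (n - m) ∂P := by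
  simp_rw [← integral_const_mul]
  rw [← integral_finsetSum _ fun m _ => (((hX.pow m).mul (hY.pow (n - m))).integrable.const_mul _)]
  congr 1 with ω
  rw [add_pow]
  refine Finset.sum_congr rfl fun m _ => ?_
  rw [mul_pow]
  ring

lemma integral_hermiteFour_mul_hermiteFour [IsProbabilityMeasure P] {X Y : Ω → ℝ}
    (hXY : ∀ a b : ℝ, HasGaussianLaw (fun ω => a * X ω + b * Y ω) P)
    (hX0 : ∫ ω, X ω ∂P = 0) (hY0 : ∫ ω, Y ω ∂P = 0) :
    ∫ ω, hermiteFour (X ω) (∫ ω', X ω' ^ 2 ∂P) * hermiteFour (Y ω) (∫ ω', Y ω' ^ 2 ∂P) ∂P =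
      24 * (∫ ω, X ω * Y ω ∂P) ^ 4 := by
  have hXg : HasGaussianLaw X P := by simpa using hXY 1 0
  have hYg : HasGaussianLaw Y P := by simpa using hXY 0 1
  have hX : HasAllMoments X P := fun p hp => hXg.memLp hp
  have hY : HasAllMoments Y P := fun p hp => hYg.memLp hp
  have hexp := integral_add_mul_pow hX hY
  have hrec (k : ℝ) (n : ℕ) := HasGaussianLaw.integral_pow_add_two
    (X := fun ω => X ω + k * Y ω) (P := P) (by simpa using hXY 1 k)
    (by rw [integral_add hX.integrable (hY.integrable.const_mul k), integral_const_mul]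
        simp [hX0, hY0]) n
  have hrecX := hXg.integral_pow_add_two hX0
  have hrecY := hYg.integral_pow_add_two hY0
  set a := ∫ ω, X ω ^ 2 ∂P with ha
  set b := ∫ ω, Y ω ^ 2 ∂P with hb
  set c := ∫ ω, X ω * Y ω ∂P with hc
  have hX4 : ∫ ω, X ω ^ 4 ∂P = 3 * a ^ 2 := by rw [hrecX 2, ← ha]; push_cast; ring
  have hY4 : ∫ ω, Y ω ^ 4 ∂P = 3 * b ^ 2 := by rw [hrecY 2, ← hb]; push_cast; ring
  have hX6 : ∫ ω, X ω ^ 6 ∂P = 15 * a ^ 3 := by rw [hrecX 4, hX4]; push_cast; ring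
  have hY6 : ∫ ω, Y ω ^ 6 ∂P = 15 * b ^ 3 := by rw [hrecY 4, hY4]; push_cast; ring
  have hX8 : ∫ ω, X ω ^ 8 ∂P = 105 * a ^ 4 := by rw [hrecX 6, hX6]; push_cast; ring
  have hY8 : ∫ ω, Y ω ^ 8 ∂P = 105 * b ^ 4 := by rw [hrecY 6, hY6]; push_cast; ring
  have e2 (k : ℝ) : ∫ ω, (X ω + k * Y ω) ^ 2 ∂P = a + 2 * k * c + k ^ 2 * b := by
    rw [hexp]
    simp [Finset.sum_range_succ, ← ha, ← hb, ← hc]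
    ring
  have e4 (k : ℝ) : ∫ ω, (X ω + k * Y ω) ^ 4 ∂P = 3 * (a + 2 * k * c + k ^ 2 * b) ^ 2 := by
    rw [hrec k 2, e2]; push_cast; ring
  have e6 (k : ℝ) : ∫ ω, (X ω + k * Y ω) ^ 6 ∂P = 15 * (a + 2 * k * c + k ^ 2 * b) ^ 3 := by
    rw [hrec k 4, e2, e4]; push_cast; ring
  have e8 (k : ℝ) : ∫ ω, (X ω + k * Y ω) ^ 8 ∂P = 105 * (a + 2 * k * c + k ^ 2 * b) ^ 4 := by
    rw [hrec k 6, e2, e6]; push_cast; ring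
  simp only [hexp, Finset.sum_range_succ, Finset.sum_range_zero, Nat.choose] at e4 e6 e8
  norm_num [hX4, hX6, hX8, hY4, hY6, hY8, Nat.choose] at e4 e6 e8
  have m22 : ∫ ω, X ω ^ 2 * Y ω ^ 2 ∂P = a * b + 2 * c ^ 2 := by
    linear_combination (e4 1 + e4 (-1)) / 12
  have m42 : ∫ ω, X ω ^ 4 * Y ω ^ 2 ∂P = 3 * a ^ 2 * b + 12 * a * c ^ 2 := by
    linear_combination (16 * (e6 1 + e6 (-1)) - (e6 2 + e6 (-2))) / 360
  have m24 : ∫ ω, X ω ^ 2 * Y ω ^ 4 ∂P = 3 * a * b ^ 2 + 12 * b * c ^ 2 := by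
    linear_combination ((e6 2 + e6 (-2)) - 4 * (e6 1 + e6 (-1))) / 360
  have m44 : ∫ ω, X ω ^ 4 * Y ω ^ 4 ∂P = 9 * a ^ 2 * b ^ 2 + 72 * a * b * c ^ 2 + 24 * c ^ 4 := by
    have h1 := e8 1
    have h2 := e8 (-1)
    have h3 := e8 2
    have h4 := e8 (-2)
    have h5 := e8 3
    have h6 := e8 (-3)
    ring_nf at h1 h2 h3 h4 h5 h6 ⊢
    linarith
  let w : Fin 3 → ℝ := ![3 * a ^ 2, -6 * a, 1]
  let u : Fin 3 → ℝ := ![3 * b ^ 2, -6 * b, 1]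
  have hpt (ω : Ω) : hermiteFour (X ω) a * hermiteFour (Y ω) b =
      ∑ i : Fin 3, ∑ j : Fin 3,
        w i * u j * (X ω ^ (2 * (i : ℕ)) * Y ω ^ (2 * (j : ℕ))) := by
    simp [Fin.sum_univ_three, hermiteFour, w, u]
    ring
  have h_int (i j : Fin 3) : Integrable
      (fun ω => w i * u j * (X ω ^ (2 * (i : ℕ)) * Y ω ^ (2 * (j : ℕ)))) P :=
    ((hX.pow _).mul (hY.pow _)).integrable.const_mul _
  simp_rw [hpt]
  rw [integral_finsetSum _ fun i _ => integrable_finsetSum _ fun j _ => h_int i j]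
  simp_rw [integral_finsetSum _ fun j _ => h_int _ j, integral_const_mul]
  simp [Fin.sum_univ_three, w, u, m22, m42, m24, m44, hX4, hY4, ← ha, ← hb]
  ring

lemma wick4_eq_sum_hermiteFour (x : Fin 4 → Ω → ℝ)
    (hx : ∀ i j, Integrable (fun ω => x i ω * x j ω) P) (ω : Ω) :
    192 * wick4 P (x 0) (x 1) (x 2) (x 3) ω =
      ∑ b, (∏ i, signVec b i) * hermiteFour (∑ i, signVec b i * x i ω)
        (∫ ω', (∑ i, signVec b i * x i ω') ^ 2 ∂P) := by
  have hvar (t : Fin 4 → ℝ) : ∫ ω', (∑ i, t i * x i ω') ^ 2 ∂P =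
      ∑ i, ∑ j, t i * t j * ∫ ω', x i ω' * x j ω' ∂P := by
    have h_int (i j : Fin 4) : Integrable (fun ω => t i * t j * (x i ω * x j ω)) P :=
      (hx i j).const_mul _
    simp_rw [← integral_const_mul]
    simp_rw [← integral_finsetSum _ fun j _ => h_int _ j]
    rw [← integral_finsetSum _ fun i _ => integrable_finsetSum _ fun j _ => h_int i j]
    congr 1 with ω'
    rw [sq, Finset.sum_mul_sum]
    exact Finset.sum_congr rfl fun i _ => Finset.sum_congr rfl fun j _ => by ring
  simp_rw [hvar]
  rw [sum_signVec_mul_hermiteFour (fun i => x i ω) (fun i j => ∫ ω', x i ω' * x j ω' ∂P)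
    fun i j => by simp_rw [mul_comm]]
  rfl

lemma integral_wick4_mul_wick4 [IsProbabilityMeasure P] (x y : Fin 4 → Ω → ℝ)
    (hg : ∀ s t : Fin 4 → ℝ, HasGaussianLaw (fun ω => ∑ i, s i * x i ω + ∑ i, t i * y i ω) P)
    (hx0 : ∀ i, ∫ ω, x i ω ∂P = 0) (hy0 : ∀ i, ∫ ω, y i ω ∂P = 0) :
    ∫ ω, wick4 P (x 0) (x 1) (x 2) (x 3) ω * wick4 P (y 0) (y 1) (y 2) (y 3) ω ∂P =
      ∑ σ : Equiv.Perm (Fin 4), ∏ i, ∫ ω, x i ω * y (σ i) ω ∂P := by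
  have hxs (s : Fin 4 → ℝ) : HasGaussianLaw (fun ω => ∑ i, s i * x i ω) P := by
    simpa using hg s 0
  have hyt (t : Fin 4 → ℝ) : HasGaussianLaw (fun ω => ∑ i, t i * y i ω) P := by
    simpa using hg 0 t
  have hx (i : Fin 4) : HasAllMoments (x i) P := fun p hp => by
    simpa [Pi.single_apply] using (hxs (Pi.single i 1)).memLp hp
  have hy (i : Fin 4) : HasAllMoments (y i) P := fun p hp => by
    simpa [Pi.single_apply] using (hyt (Pi.single i 1)).memLp hp
  have hxs0 (s : Fin 4 → ℝ) : ∫ ω, ∑ i, s i * x i ω ∂P = 0 := by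
    rw [integral_finsetSum _ fun i _ => (hx i).integrable.const_mul _]
    simp [integral_const_mul, hx0]
  have hyt0 (t : Fin 4 → ℝ) : ∫ ω, ∑ i, t i * y i ω ∂P = 0 := by
    rw [integral_finsetSum _ fun i _ => (hy i).integrable.const_mul _]
    simp [integral_const_mul, hy0]
  have hxy (s t : Fin 4 → ℝ) (a b : ℝ) :
      HasGaussianLaw (fun ω => a * ∑ i, s i * x i ω + b * ∑ i, t i * y i ω) P := by
    simpa [Finset.mul_sum, mul_assoc] using hg (fun i => a * s i) (fun i => b * t i)
  have hcov (s t : Fin 4 → ℝ) : ∫ ω, (∑ i, s i * x i ω) * (∑ j, t j * y j ω) ∂P =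
      ∑ i, s i * ∑ j, t j * ∫ ω, x i ω * y j ω ∂P := by
    have h_int (i j : Fin 4) : Integrable (fun ω => s i * (t j * (x i ω * y j ω))) P :=
      (((hx i).mul (hy j)).integrable.const_mul _).const_mul _
    simp_rw [Finset.mul_sum, ← integral_const_mul]
    simp_rw [← integral_finsetSum _ fun j _ => h_int _ j]
    rw [← integral_finsetSum _ fun i _ => integrable_finsetSum _ fun j _ => h_int i j]
    congr 1 with ω
    rw [Finset.sum_comm]
    simp_rw [Finset.sum_mul]
    exact Finset.sum_congr rfl fun i _ => Finset.sum_congr rfl fun j _ => by ring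
  set H := fun (z : Fin 4 → Ω → ℝ) (b : Bool × Bool × Bool) (ω : Ω) =>
    hermiteFour (∑ i, signVec b i * z i ω) (∫ ω', (∑ i, signVec b i * z i ω') ^ 2 ∂P) with hH
  have hHx (b) : HasAllMoments (H x b) P :=
    HasAllMoments.hermiteFour (fun p hp => (hxs (signVec b)).memLp hp) _
  have hHy (b) : HasAllMoments (H y b) P :=
    HasAllMoments.hermiteFour (fun p hp => (hyt (signVec b)).memLp hp) _
  have hHH (b d) : ∫ ω, H x b ω * H y d ω ∂P =
      24 * (∑ i, signVec b i * ∑ j, signVec d j * ∫ ω, x i ω * y j ω ∂P) ^ 4 := by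
    rw [← hcov]
    exact integral_hermiteFour_mul_hermiteFour (hxy _ _) (hxs0 _) (hyt0 _)
  have hpt (ω : Ω) : wick4 P (x 0) (x 1) (x 2) (x 3) ω * wick4 P (y 0) (y 1) (y 2) (y 3) ω =
      (192 * 192)⁻¹ * ∑ d, ∑ b,
        (∏ i, signVec d i) * ((∏ i, signVec b i) * (H x b ω * H y d ω)) := by
    have h1 := wick4_eq_sum_hermiteFour (P := P) x (fun i j => ((hx i).mul (hx j)).integrable) ω
    have h2 := wick4_eq_sum_hermiteFour (P := P) y (fun i j => ((hy i).mul (hy j)).integrable) ω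
    have h3 : ∑ d, ∑ b, (∏ i, signVec d i) * ((∏ i, signVec b i) * (H x b ω * H y d ω)) =
        (∑ b, (∏ i, signVec b i) * H x b ω) * ∑ d, (∏ i, signVec d i) * H y d ω := by
      rw [Finset.sum_mul_sum, Finset.sum_comm]
      exact Finset.sum_congr rfl fun b _ => Finset.sum_congr rfl fun d _ => by ring
    rw [h3, ← h1, ← h2]
    ring
  have h_int (b d) : Integrable
      (fun ω => (∏ i, signVec d i) * ((∏ i, signVec b i) * (H x b ω * H y d ω))) P :=
    (((hHx b).mul (hHy d)).integrable.const_mul _).const_mul _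
  simp_rw [hpt]
  rw [integral_const_mul,
    integral_finsetSum _ fun d _ => integrable_finsetSum _ fun b _ => h_int b d]
  simp_rw [integral_finsetSum _ fun b _ => h_int b _, integral_const_mul, hHH,
    mul_left_comm _ (24 : ℝ), ← Finset.mul_sum, sum_signVec_mul_pow_four,
    mul_left_comm _ (192 : ℝ), ← Finset.mul_sum]
  rw [sum_signVec_mul_prod fun i j => ∫ ω, x i ω * y j ω ∂P]
  ring

lemma IsJointlyGaussianCentered.hasGaussianLaw {n : ℕ} {ξ : Fin n → Ω → ℝ}
    (h : IsJointlyGaussianCentered P ξ) : HasGaussianLaw (fun ω i => ξ i ω) P :=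
  ⟨isGaussian_of_map_eq_gaussianReal h.2.1⟩

lemma IsJointlyGaussianCentered.hasGaussianLaw_sum {n : ℕ} {ξ : Fin n → Ω → ℝ}
    (h : IsJointlyGaussianCentered P ξ) (t : Fin n → ℝ) :
    HasGaussianLaw (fun ω => ∑ i, t i * ξ i ω) P := by
  let L : (Fin n → ℝ) →L[ℝ] ℝ := ∑ i, t i • ContinuousLinearMap.proj (φ := fun _ => ℝ) i
  simpa [L, sum_apply] using h.hasGaussianLaw.map_fun L

end Gauss

/-- `E[:ξ₁₁ξ₁₂ξ₁₃ξ₁₄: :ξ₂₁ξ₂₂ξ₂₃ξ₂₄:] = ∑_σ ∏_{i=1}^{4} E[ξ₁ᵢξ₂σ(i)]`, the sum running over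
all 24 permutations of `{1,2,3,4}`, for jointly Gaussian centered random variables. -/
theorem wick4_product_expectation
    {Ω : Type*} [MeasurableSpace Ω] (P : Measure Ω) [IsProbabilityMeasure P]
    (ξ₁₁ ξ₁₂ ξ₁₃ ξ₁₄ ξ₂₁ ξ₂₂ ξ₂₃ ξ₂₄ : Ω → ℝ)
    (hgauss : IsJointlyGaussianCentered P ![ξ₁₁, ξ₁₂, ξ₁₃, ξ₁₄, ξ₂₁, ξ₂₂, ξ₂₃, ξ₂₄]) :
    ∫ ω, wick4 P ξ₁₁ ξ₁₂ ξ₁₃ ξ₁₄ ω * wick4 P ξ₂₁ ξ₂₂ ξ₂₃ ξ₂₄ ω ∂P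
      = ∑ σ : Equiv.Perm (Fin 4),
          ∏ i : Fin 4,
            ∫ ω, (![ξ₁₁, ξ₁₂, ξ₁₃, ξ₁₄] i) ω * (![ξ₂₁, ξ₂₂, ξ₂₃, ξ₂₄] (σ i)) ω ∂P := by
  refine integral_wick4_mul_wick4 ![ξ₁₁, ξ₁₂, ξ₁₃, ξ₁₄] ![ξ₂₁, ξ₂₂, ξ₂₃, ξ₂₄] (fun s t => ?_) ?_ ?_
  · simpa [Fin.sum_univ_succ, add_assoc] using
      hgauss.hasGaussianLaw_sum ![s 0, s 1, s 2, s 3, t 0, t 1, t 2, t 3]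
  · intro i
    fin_cases i
    exacts [hgauss.2.2 0, hgauss.2.2 1, hgauss.2.2 2, hgauss.2.2 3]
  · intro i
    fin_cases i
    exacts [hgauss.2.2 4, hgauss.2.2 5, hgauss.2.2 6, hgauss.2.2 7]
end

section
/- Let u : ℝ² → ℝ² be a smooth ℤ²-periodic vector field with div u = 0. Then ∫_{[0,1]²} ((u·∇)u)·Δu dx = 0, where Δu denotes the componentwise Laplacian of u. -/
open MeasureTheory

/-- The integral over the unit cube of the divergence of a `C¹` periodic vector field vanishes. -/
theorem integral_divergence_eq_zero_of_periodic {n : ℕ} (f : Fin (n + 1) → (Fin (n + 1) → ℝ) → ℝ)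
    (hf : ∀ i, ContDiff ℝ 1 (f i))
    (hper : ∀ i (x : Fin (n + 1) → ℝ) (k : Fin (n + 1) → ℤ), f i (x + fun j => (k j : ℝ)) = f i x) :
    ∫ x in Set.Icc (0 : Fin (n + 1) → ℝ) 1, ∑ i, fderiv ℝ (f i) x (Pi.single i 1) = 0 := by
  rw [integral_divergence_of_hasFDerivAt_off_countable' (0 : Fin (n + 1) → ℝ) 1 zero_le_one f
    (fun i => fderiv ℝ (f i)) ∅ Set.countable_empty (fun i => (hf i).continuous.continuousOn)
    (fun x _ i => ((hf i).differentiable one_ne_zero x).hasFDerivAt)]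
  · refine Finset.sum_eq_zero fun i _ => sub_eq_zero.2 (integral_congr_ae (.of_forall fun x => ?_))
    have h := hper i (i.insertNth 0 x) (Pi.single i 1)
    refine Eq.trans (congrArg (f i) ?_) h
    refine (Fin.insertNth_eq_iff).2 ⟨?_, ?_⟩
    · simp
    · ext j
      simp [Fin.removeNth]
  · refine Continuous.integrableOn_Icc (continuous_finsetSum _ fun i _ => ?_)
    exact ((hf i).continuous_fderiv one_ne_zero).clm_apply continuous_const

/-- A directional derivative of a smooth function is smooth. -/
theorem ContDiff.fderiv_apply_const {E : Type*} [NormedAddCommGroup E] [NormedSpace ℝ E]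
    {g : E → ℝ} (hg : ContDiff ℝ (⊤ : ℕ∞) g) (v : E) :
    ContDiff ℝ (⊤ : ℕ∞) fun x => fderiv ℝ g x v :=
  (hg.fderiv_right (m := (⊤ : ℕ∞)) (by simp)).clm_apply contDiff_const

/-- Directional derivatives of a smooth function commute. -/
theorem ContDiff.fderiv_fderiv_apply_comm {E : Type*} [NormedAddCommGroup E] [NormedSpace ℝ E]
    {g : E → ℝ} (hg : ContDiff ℝ (⊤ : ℕ∞) g) (v w x : E) :
    fderiv ℝ (fun y => fderiv ℝ g y v) x w = fderiv ℝ (fun y => fderiv ℝ g y w) x v := by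
  have hd : DifferentiableAt ℝ (fderiv ℝ g) x :=
    (hg.fderiv_right (m := (⊤ : ℕ∞)) (by simp)).differentiable (by simp) x
  have hs : IsSymmSndFDerivAt ℝ g x :=
    (contDiff_infty.1 hg 2).contDiffAt.isSymmSndFDerivAt (by simp)
  simpa [fderiv_clm_apply hd (differentiableAt_const _)] using hs w v

/-- Partial derivatives of a periodic function are periodic. -/
theorem fderiv_apply_add_of_periodic {E : Type*} [NormedAddCommGroup E] [NormedSpace ℝ E]
    {g : E → ℝ} {c : E} (hg : ∀ x, g (x + c) = g x) (v x : E) :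
    fderiv ℝ g (x + c) v = fderiv ℝ g x v := by
  rw [← fderiv_comp_add_right, funext hg]

/-- For a smooth `ℤ²`-periodic vector field `u : ℝ² → ℝ²` with `div u = 0`,
`∫_{[0,1]²} ((u·∇)u)·Δu dx = 0`, where `Δu` is the componentwise Laplacian. -/
theorem nse_2d_enstrophy_identity
    (u : (Fin 2 → ℝ) → (Fin 2 → ℝ))
    (hu : ContDiff ℝ (⊤ : ℕ∞) u)
    (huper : ∀ (x : Fin 2 → ℝ) (k : Fin 2 → ℤ), u (x + (fun i => (k i : ℝ))) = u x)
    (hdivu : ∀ x : Fin 2 → ℝ, ∑ j, fderiv ℝ (fun y => u y j) x (Pi.single j 1) = 0) :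
    (∫ x in Set.Icc (0 : Fin 2 → ℝ) 1,
        ∑ i, (∑ j, u x j * fderiv ℝ (fun y => u y i) x (Pi.single j 1))
          * (∑ j, fderiv ℝ (fun y => fderiv ℝ (fun z => u z i) y (Pi.single j 1)) x
              (Pi.single j 1))) = 0 := by
  have hc (i : Fin 2) : ContDiff ℝ (⊤ : ℕ∞) fun y => u y i := contDiff_pi.1 hu i
  let d (i j : Fin 2) (x : Fin 2 → ℝ) : ℝ := fderiv ℝ (fun y => u y i) x (Pi.single j 1)
  have hd (i j) : ContDiff ℝ (⊤ : ℕ∞) (d i j) := (hc i).fderiv_apply_const _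
  have hdper (i j x) (k : Fin 2 → ℤ) : d i j (x + fun l => (k l : ℝ)) = d i j x :=
    fderiv_apply_add_of_periodic (fun y => congrFun (huper y k) i) _ x
  have hdiv (x) : d 0 0 x + d 1 1 x = 0 := by simpa [Fin.sum_univ_two] using hdivu x
  have hdiv' (x v) : fderiv ℝ (d 1 1) x v = -fderiv ℝ (d 0 0) x v := by
    rw [show d 1 1 = fun y => -d 0 0 y from funext fun y => by linarith [hdiv y], fderiv_fun_neg]
    rfl
  have hsymm (i j l x) : fderiv ℝ (d i j) x (Pi.single l 1) = fderiv ℝ (d i l) x (Pi.single j 1) :=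
    (hc i).fderiv_fderiv_apply_comm _ _ x
  -- With `ω = ∂₁u₂ - ∂₂u₁` and `q = |u|² / 2`, the integrand is the divergence of
  -- `(ω ∂₂q + u₁ ω² / 2, -ω ∂₁q + u₂ ω² / 2)`.
  let ω (x : Fin 2 → ℝ) : ℝ := d 1 0 x - d 0 1 x
  let q (j : Fin 2) (x : Fin 2 → ℝ) : ℝ := u x 0 * d 0 j x + u x 1 * d 1 j x
  let s : Fin 2 → ℝ := ![1, -1]
  let f (i : Fin 2) (x : Fin 2 → ℝ) : ℝ := s i * (q (1 - i) x * ω x) + u x i * (ω x * ω x) / 2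
  have hω : ContDiff ℝ (⊤ : ℕ∞) ω := (hd 1 0).sub (hd 0 1)
  have hq (j) : ContDiff ℝ (⊤ : ℕ∞) (q j) := ((hc 0).mul (hd 0 j)).add ((hc 1).mul (hd 1 j))
  have hf (i) : ContDiff ℝ (⊤ : ℕ∞) (f i) :=
    (contDiff_const.mul ((hq _).mul hω)).add (((hc i).mul (hω.mul hω)).div_const 2)
  have hcd (i x) := ((hc i).differentiable (by simp) x).hasFDerivAt
  have hdd (i j x) := ((hd i j).differentiable (by simp) x).hasFDerivAt
  have key := integral_divergence_eq_zero_of_periodic f (fun i => (hf i).of_le (by simp))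
    (fun i x k => by simp only [f, q, ω, huper, hdper])
  rw [← key]
  refine integral_congr_ae (.of_forall fun x => ?_)
  have hω' : HasFDerivAt ω _ x := (hdd 1 0 x).sub (hdd 0 1 x)
  have hq' (j) : HasFDerivAt (q j) _ x :=
    ((hcd 0 x).mul (hdd 0 j x)).add ((hcd 1 x).mul (hdd 1 j x))
  have hf' (i) : HasFDerivAt (f i) _ x :=
    (((hq' (1 - i)).mul hω').const_mul (s i)).add
      (((hcd i x).mul (hω'.mul hω')).mul_const (2⁻¹ : ℝ))
  simp only [Fin.sum_univ_two, (hf' _).fderiv]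
  change (u x 0 * d 0 0 x + u x 1 * d 0 1 x) *
      (fderiv ℝ (d 0 0) x (Pi.single 0 1) + fderiv ℝ (d 0 1) x (Pi.single 1 1)) +
    (u x 0 * d 1 0 x + u x 1 * d 1 1 x) *
      (fderiv ℝ (d 1 0) x (Pi.single 0 1) + fderiv ℝ (d 1 1) x (Pi.single 1 1)) = _
  have h11 : d 1 1 x = -d 0 0 x := by linarith [hdiv x]
  have e (i j) : fderiv ℝ (fun y => u y i) x (Pi.single j 1) = d i j x := rfl
  simp [e, s, q, ω, hdiv', hsymm 0 1 0, hsymm 1 0 1, h11]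
  ring
end

section
/- Let u : ℝ² → ℝ² be a smooth ℤ²-periodic vector field with div u = 0, and let ω = ∂₁u₂ − ∂₂u₁ be its scalar curl. Then ∫_{[0,1]²} ((u·∇)u)·Δu dx = − ∫_{[0,1]²} ((u·∇)ω) · ω dx, where (u·∇)ω = ∑_{j=1}^{2} u_j ∂_j ω. -/
/-- The `j`-th partial derivative of a scalar function on the plane. -/
noncomputable def partialDeriv (j : Fin 2) (f : (Fin 2 → ℝ) → ℝ) (x : Fin 2 → ℝ) : ℝ :=
  fderiv ℝ f x (Pi.single j 1)

section PartialDeriv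

variable {f g : (Fin 2 → ℝ) → ℝ}

theorem ContDiff.partialDeriv (hf : ContDiff ℝ (⊤ : ℕ∞) f) (j : Fin 2) :
    ContDiff ℝ (⊤ : ℕ∞) (partialDeriv j f) :=
  (hf.fderiv_right (m := (⊤ : ℕ∞)) (by simp)).clm_apply contDiff_const

theorem ContDiff.differentiableAt_of_smooth (hf : ContDiff ℝ (⊤ : ℕ∞) f) (x : Fin 2 → ℝ) :
    DifferentiableAt ℝ f x :=
  hf.differentiable (by simp) x

theorem partialDeriv_add (hf : ContDiff ℝ (⊤ : ℕ∞) f) (hg : ContDiff ℝ (⊤ : ℕ∞) g)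
    (j : Fin 2) (x : Fin 2 → ℝ) :
    partialDeriv j (fun y => f y + g y) x = partialDeriv j f x + partialDeriv j g x := by
  simp [partialDeriv,
    fderiv_fun_add (hf.differentiableAt_of_smooth x) (hg.differentiableAt_of_smooth x)]

theorem partialDeriv_sub (hf : ContDiff ℝ (⊤ : ℕ∞) f) (hg : ContDiff ℝ (⊤ : ℕ∞) g)
    (j : Fin 2) (x : Fin 2 → ℝ) :
    partialDeriv j (fun y => f y - g y) x = partialDeriv j f x - partialDeriv j g x := by
  simp [partialDeriv,
    fderiv_fun_sub (hf.differentiableAt_of_smooth x) (hg.differentiableAt_of_smooth x)]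

theorem partialDeriv_neg (j : Fin 2) (x : Fin 2 → ℝ) :
    partialDeriv j (fun y => -f y) x = -partialDeriv j f x := by
  simp [partialDeriv]

theorem partialDeriv_mul (hf : ContDiff ℝ (⊤ : ℕ∞) f) (hg : ContDiff ℝ (⊤ : ℕ∞) g)
    (j : Fin 2) (x : Fin 2 → ℝ) :
    partialDeriv j (fun y => f y * g y) x
      = f x * partialDeriv j g x + g x * partialDeriv j f x := by
  simp [partialDeriv,
    fderiv_fun_mul (hf.differentiableAt_of_smooth x) (hg.differentiableAt_of_smooth x)]

theorem partialDeriv_comm (hf : ContDiff ℝ (⊤ : ℕ∞) f) (i j : Fin 2) (x : Fin 2 → ℝ) :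
    partialDeriv i (partialDeriv j f) x = partialDeriv j (partialDeriv i f) x := by
  have hd : DifferentiableAt ℝ (fderiv ℝ f) x :=
    (hf.fderiv_right (m := (⊤ : ℕ∞)) (by simp)).differentiable (by simp) x
  have h (k l : Fin 2) : partialDeriv k (partialDeriv l f) x
      = fderiv ℝ (fderiv ℝ f) x (Pi.single k 1) (Pi.single l 1) := by
    change fderiv ℝ (fun y => fderiv ℝ f y (Pi.single l 1)) x (Pi.single k 1) = _
    simp [fderiv_clm_apply hd (differentiableAt_const _)]
  have hs : IsSymmSndFDerivAt ℝ f x :=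
    hf.contDiffAt.isSymmSndFDerivAt
      (by simpa using WithTop.coe_le_coe.mpr (le_top : (2 : ℕ∞) ≤ ⊤))
  rw [h, h, hs.eq]

theorem partialDeriv_periodic {c : Fin 2 → ℝ} (hf : Function.Periodic f c) (j : Fin 2) :
    Function.Periodic (partialDeriv j f) c := by
  intro x
  simp only [partialDeriv]
  rw [← fderiv_comp_add_right, funext hf]

theorem integral_divergence_unitSquare_eq_zero_of_periodic {F : Fin 2 → (Fin 2 → ℝ) → ℝ}
    (hF : ∀ i, ContDiff ℝ (⊤ : ℕ∞) (F i))
    (hper : ∀ i, Function.Periodic (F i) (Pi.single i 1)) :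
    ∫ x in Set.Icc (0 : Fin 2 → ℝ) 1, ∑ i, partialDeriv i (F i) x = 0 := by
  have h := MeasureTheory.integral_divergence_of_hasFDerivAt_off_countable' (0 : Fin 2 → ℝ) 1 zero_le_one F
    (fun i => fderiv ℝ (F i)) ∅ Set.countable_empty (fun i => (hF i).continuous.continuousOn)
    (fun x _ i => ((hF i).differentiableAt_of_smooth x).hasFDerivAt)
    ((continuous_finsetSum _ fun i _ =>
      ((hF i).partialDeriv i).continuous).continuousOn.integrableOn_compact isCompact_Icc)
  refine h.trans (Finset.sum_eq_zero fun i _ => sub_eq_zero.mpr ?_)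
  congr 1
  funext y
  refine Eq.trans ?_ (hper i _)
  congr 1
  ext k
  refine Fin.succAboveCases i ?_ (fun l => ?_) k <;> simp

/-- The planar identity `∫ ((u·∇)u)·Δu = -∫ ((u·∇)ω) ω` in terms of the components `f`, `g` of a
divergence-free field and its scalar curl `w`. -/
theorem integral_advection_mul_laplacian_eq_neg {w : (Fin 2 → ℝ) → ℝ}
    (hf : ContDiff ℝ (⊤ : ℕ∞) f) (hg : ContDiff ℝ (⊤ : ℕ∞) g)
    (hfper : ∀ i, Function.Periodic f (Pi.single i 1))
    (hgper : ∀ i, Function.Periodic g (Pi.single i 1))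
    (hdiv : ∀ x, partialDeriv 0 f x + partialDeriv 1 g x = 0)
    (hcurl : ∀ x, w x = partialDeriv 0 g x - partialDeriv 1 f x) :
    (∫ x in Set.Icc (0 : Fin 2 → ℝ) 1,
      ((f x * partialDeriv 0 f x + g x * partialDeriv 1 f x)
        * (partialDeriv 0 (partialDeriv 0 f) x + partialDeriv 1 (partialDeriv 1 f) x)
      + (f x * partialDeriv 0 g x + g x * partialDeriv 1 g x)
        * (partialDeriv 0 (partialDeriv 0 g) x + partialDeriv 1 (partialDeriv 1 g) x)))
    = -∫ x in Set.Icc (0 : Fin 2 → ℝ) 1,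
      (f x * partialDeriv 0 w x + g x * partialDeriv 1 w x) * w x := by
  obtain rfl : w = fun x => partialDeriv 0 g x - partialDeriv 1 f x := funext hcurl
  set w : (Fin 2 → ℝ) → ℝ := fun x => partialDeriv 0 g x - partialDeriv 1 f x with hw
  have hf₁ := hf.partialDeriv
  have hg₁ := hg.partialDeriv
  have hws : ContDiff ℝ (⊤ : ℕ∞) w := (hg₁ 0).sub (hf₁ 1)
  have hwper (i : Fin 2) : Function.Periodic w (Pi.single i 1) :=
    (partialDeriv_periodic (hgper i) 0).sub (partialDeriv_periodic (hfper i) 1)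
  have hadv {h : (Fin 2 → ℝ) → ℝ} (hh : ContDiff ℝ (⊤ : ℕ∞) h) :
      ContDiff ℝ (⊤ : ℕ∞) (fun x => f x * partialDeriv 0 h x + g x * partialDeriv 1 h x) :=
    (hf.mul (hh.partialDeriv 0)).add (hg.mul (hh.partialDeriv 1))
  have hadvper {h : (Fin 2 → ℝ) → ℝ} (i : Fin 2) (hh : Function.Periodic h (Pi.single i 1)) :
      Function.Periodic (fun x => f x * partialDeriv 0 h x + g x * partialDeriv 1 h x)
        (Pi.single i 1) :=
    ((hfper i).mul (partialDeriv_periodic hh 0)).add ((hgper i).mul (partialDeriv_periodic hh 1))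
  have hlap {h : (Fin 2 → ℝ) → ℝ} (hh : ContDiff ℝ (⊤ : ℕ∞) h) :
      ContDiff ℝ (⊤ : ℕ∞)
        (fun x => partialDeriv 0 (partialDeriv 0 h) x + partialDeriv 1 (partialDeriv 1 h) x) :=
    ((hh.partialDeriv 0).partialDeriv 0).add ((hh.partialDeriv 1).partialDeriv 1)
  have hdiv' (i : Fin 2) (x : Fin 2 → ℝ) :
      partialDeriv i (partialDeriv 0 f) x + partialDeriv i (partialDeriv 1 g) x = 0 := by
    rw [← partialDeriv_add (hf₁ 0) (hg₁ 1), funext hdiv]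
    simp [partialDeriv]
  have key := integral_divergence_unitSquare_eq_zero_of_periodic
    (F := ![fun x => (f x * partialDeriv 0 g x + g x * partialDeriv 1 g x) * w x,
      fun x => -((f x * partialDeriv 0 f x + g x * partialDeriv 1 f x) * w x)])
    (Fin.forall_fin_two.mpr ⟨(hadv hg).mul hws, ((hadv hf).mul hws).neg⟩)
    (Fin.forall_fin_two.mpr ⟨(hadvper 0 (hgper 0)).mul (hwper 0),
      fun x => congrArg Neg.neg (((hadvper 1 (hfper 1)).mul (hwper 1)) x)⟩)
  rw [eq_neg_iff_add_eq_zero, ← MeasureTheory.integral_add, ← key]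
  · congr 1
    funext x
    simp only [Fin.sum_univ_two, Matrix.cons_val_zero, Matrix.cons_val_one]
    rw [partialDeriv_neg, partialDeriv_mul (hadv hg) hws, partialDeriv_mul (hadv hf) hws,
      partialDeriv_add (hf.mul (hg₁ 0)) (hg.mul (hg₁ 1)),
      partialDeriv_add (hf.mul (hf₁ 0)) (hg.mul (hf₁ 1)),
      partialDeriv_mul hf (hg₁ 0), partialDeriv_mul hg (hg₁ 1),
      partialDeriv_mul hf (hf₁ 0), partialDeriv_mul hg (hf₁ 1), hw,
      partialDeriv_sub (hg₁ 0) (hf₁ 1), partialDeriv_sub (hg₁ 0) (hf₁ 1)]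
    have h₀ := hdiv' 0 x
    have h₁ := hdiv' 1 x
    rw [partialDeriv_comm hf 1 0] at h₁ ⊢
    rw [partialDeriv_comm hg 1 0]
    linear_combination (f x * partialDeriv 0 f x + g x * partialDeriv 1 f x) * h₀
      + (f x * partialDeriv 0 g x + g x * partialDeriv 1 g x) * h₁
      - (partialDeriv 0 g x - partialDeriv 1 f x) ^ 2 * hdiv x
  · exact (((hadv hf).mul (hlap hf)).add ((hadv hg).mul (hlap hg))).continuous.continuousOn
      |>.integrableOn_compact isCompact_Icc
  · exact ((hadv hws).mul hws).continuous.continuousOn.integrableOn_compact isCompact_Icc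

end PartialDeriv



/-- For a smooth `ℤ²`-periodic vector field `u : ℝ² → ℝ²` with `div u = 0` and scalar curl
`ω = ∂₁u₂ - ∂₂u₁`, one has
`∫_{[0,1]²} ((u·∇)u)·Δu dx = - ∫_{[0,1]²} ((u·∇)ω) ω dx`. -/
theorem nse_2d_vorticity_identity
    (u : (Fin 2 → ℝ) → (Fin 2 → ℝ))
    (hu : ContDiff ℝ (⊤ : ℕ∞) u)
    (huper : ∀ (x : Fin 2 → ℝ) (k : Fin 2 → ℤ), u (x + (fun i => (k i : ℝ))) = u x)
    (hdivu : ∀ x : Fin 2 → ℝ, ∑ j, fderiv ℝ (fun y => u y j) x (Pi.single j 1) = 0)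
    (ω : (Fin 2 → ℝ) → ℝ)
    (hω : ∀ x : Fin 2 → ℝ,
      ω x = fderiv ℝ (fun y => u y 1) x (Pi.single 0 1)
        - fderiv ℝ (fun y => u y 0) x (Pi.single 1 1)) :
    (∫ x in Set.Icc (0 : Fin 2 → ℝ) 1,
        ∑ i, (∑ j, u x j * fderiv ℝ (fun y => u y i) x (Pi.single j 1))
          * (∑ j, fderiv ℝ (fun y => fderiv ℝ (fun z => u z i) y (Pi.single j 1)) x
              (Pi.single j 1)))
      = - ∫ x in Set.Icc (0 : Fin 2 → ℝ) 1,
            (∑ j, u x j * fderiv ℝ ω x (Pi.single j 1)) * ω x := by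
  have hc (i : Fin 2) : ContDiff ℝ (⊤ : ℕ∞) (fun y => u y i) := contDiff_pi.mp hu i
  have hp (j : Fin 2) : Function.Periodic u (Pi.single j 1) := fun x => by
    convert huper x (Pi.single j 1) using 3
    ext i
    by_cases h : i = j
    · subst h; simp
    · simp [h]
  have hcp (i j : Fin 2) : Function.Periodic (fun y => u y i) (Pi.single j 1) :=
    fun x => congrFun (hp j x) i
  simp only [Fin.sum_univ_two] at hdivu ⊢
  exact integral_advection_mul_laplacian_eq_neg (hc 0) (hc 1) (hcp 0) (hcp 1) hdivu hω
end
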